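/- Δ_P vanishes if and only if the state is fully product: Δ_P(A₁:⋯:Aₙ) = 0 ⟺ ρ_{A₁⋯Aₙ} = ρ_{A₁} ⊗ ⋯ ⊗ ρ_{Aₙ}. -/

import Mathlib

open scoped BigOperators ComplexOrder

noncomputable section

/-- Von Neumann entropy of a matrix: `−∑ λᵢ log λᵢ` over its eigenvalues
(defined to be `0` if the matrix is not Hermitian). -/
noncomputable def matEntropy {ι : Type} [Fintype ι] [DecidableEq ι]
    (ρ : Matrix ι ι ℂ) : ℝ :=
  if h : ρ.IsHermitian then ∑ i, Real.negMulLog (h.eigenvalues i) else 0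

/-- A density matrix: positive semidefinite with unit trace. -/
def IsDensityMatrix {ι : Type} [Fintype ι] (ρ : Matrix ι ι ℂ) : Prop :=
  ρ.PosSemidef ∧ ρ.trace = 1

instance sumElimFintype {κ π : Type} {α : κ → Type} {δ : π → Type}
    [∀ i, Fintype (α i)] [∀ k, Fintype (δ k)] :
    ∀ i : κ ⊕ π, Fintype (Sum.elim α δ i)
  | .inl a => inferInstanceAs (Fintype (α a))
  | .inr b => inferInstanceAs (Fintype (δ b))

instance sumElimDecEq {κ π : Type} {α : κ → Type} {δ : π → Type}
    [∀ i, DecidableEq (α i)] [∀ k, DecidableEq (δ k)] :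
    ∀ i : κ ⊕ π, DecidableEq (Sum.elim α δ i)
  | .inl a => inferInstanceAs (DecidableEq (α a))
  | .inr b => inferInstanceAs (DecidableEq (δ b))

/-- Reduced density matrix on the subsystems in `s` (partial trace over the rest). -/
noncomputable def reduce {κ : Type} [Fintype κ] [DecidableEq κ] {α : κ → Type}
    [∀ i, Fintype (α i)] (s : Finset κ)
    (ρ : Matrix (∀ i, α i) (∀ i, α i) ℂ) :
    Matrix (∀ i : {j // j ∈ s}, α i.1) (∀ i : {j // j ∈ s}, α i.1) ℂ :=
  Matrix.of fun f g => ∑ h : ∀ i : {j // j ∉ s}, α i.1,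
    ρ (fun i => if hi : i ∈ s then f ⟨i, hi⟩ else h ⟨i, hi⟩)
      (fun i => if hi : i ∈ s then g ⟨i, hi⟩ else h ⟨i, hi⟩)

/-- The (pure) density matrix `|ψ⟩⟨ψ|` of a state vector. -/
def vecState {ι : Type} (ψ : ι → ℂ) : Matrix ι ι ℂ :=
  Matrix.of fun x y => ψ x * star (ψ y)

/-- Multipartite mutual information `∑ᵢ S_{Aᵢ} − S_{A₁⋯Aₙ}`. -/
noncomputable def Imulti {κ : Type} [Fintype κ] [DecidableEq κ] {α : κ → Type}
    [∀ i, Fintype (α i)] [∀ i, DecidableEq (α i)]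
    (ρ : Matrix (∀ i, α i) (∀ i, α i) ℂ) : ℝ :=
  (∑ i, matEntropy (reduce {i} ρ)) - matEntropy ρ

/-- Merge an assignment on the original systems with one on the ancillas. -/
def mergeSum {κ π : Type} {α : κ → Type} {δ : π → Type}
    (f : ∀ i, α i) (h : ∀ k, δ k) : ∀ i : κ ⊕ π, Sum.elim α δ i
  | .inl a => f a
  | .inr b => h b

/-- The subsystems belonging to party `k` together with its ancilla. -/
def partyFinset {κ π : Type} [Fintype κ] [DecidableEq κ] [DecidableEq π]
    (p : κ → π) (k : π) : Finset (κ ⊕ π) :=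
  (Finset.univ.filter fun i => p i = k).image Sum.inl ∪ {Sum.inr k}

/-- `ψ` (on the original systems plus one ancilla `Fin (d k)` per party)
purifies `ρ`: tracing out all ancillas from `|ψ⟩⟨ψ|` gives back `ρ`. -/
def Purifies {κ π : Type} [Fintype κ] {α : κ → Type} [∀ i, Fintype (α i)]
    [Fintype π] [DecidableEq π] {d : π → ℕ}
    (ψ : (∀ i : κ ⊕ π, Sum.elim α (fun k => Fin (d k)) i) → ℂ)
    (ρ : Matrix (∀ i, α i) (∀ i, α i) ℂ) : Prop :=
  ∀ f g, (∑ h : ∀ k, Fin (d k), vecState ψ (mergeSum f h) (mergeSum g h)) = ρ f g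

/-- Multipartite entanglement of purification for the partition of the systems `κ`
into parties `π` given by `p`: the infimum over all purifications (with one ancilla
per party, of arbitrary finite dimension) of `∑ₖ S_{AₖAₖ'}`. -/
noncomputable def DeltaPart {κ π : Type} [Fintype κ] [DecidableEq κ]
    [Fintype π] [DecidableEq π] {α : κ → Type}
    [∀ i, Fintype (α i)] [∀ i, DecidableEq (α i)]
    (p : κ → π) (ρ : Matrix (∀ i, α i) (∀ i, α i) ℂ) : ℝ :=
  sInf { x | ∃ (d : π → ℕ) (ψ : (∀ i : κ ⊕ π, Sum.elim α (fun k => Fin (d k)) i) → ℂ),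
    Purifies ψ ρ ∧
    x = ∑ k : π, matEntropy (reduce (partyFinset p k) (vecState ψ)) }

/-- Bipartite-style entanglement of purification for the partition `p`:
the infimum over purifications of the entropy of the single party `k₀`
together with its ancilla. -/
noncomputable def EPart {κ π : Type} [Fintype κ] [DecidableEq κ]
    [Fintype π] [DecidableEq π] {α : κ → Type}
    [∀ i, Fintype (α i)] [∀ i, DecidableEq (α i)]
    (p : κ → π) (k₀ : π) (ρ : Matrix (∀ i, α i) (∀ i, α i) ℂ) : ℝ :=
  sInf { x | ∃ (d : π → ℕ) (ψ : (∀ i : κ ⊕ π, Sum.elim α (fun k => Fin (d k)) i) → ℂ),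
    Purifies ψ ρ ∧
    x = matEntropy (reduce (partyFinset p k₀) (vecState ψ)) }

/-- The tensor product of the single-site marginals `ρ_{A₁} ⊗ ⋯ ⊗ ρ_{Aₙ}`. -/
noncomputable def prodMarginals {κ : Type} [Fintype κ] [DecidableEq κ]
    {α : κ → Type} [∀ i, Fintype (α i)]
    (ρ : Matrix (∀ i, α i) (∀ i, α i) ℂ) :
    Matrix (∀ i, α i) (∀ i, α i) ℂ :=
  Matrix.of fun f g => ∏ i, reduce {i} ρ (fun j => f j.1) (fun j => g j.1)

lemma Matrix.IsHermitian.trace_mul_self_eq_sum_eigenvalues_sq {ι : Type} [Fintype ι] [DecidableEq ι]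
    {σ : Matrix ι ι ℂ} (h : σ.IsHermitian) :
    (σ * σ).trace = ∑ i, ((h.eigenvalues i : ℂ)) ^ 2 := by
  conv_lhs => rw [h.spectral_theorem, ← map_mul, Matrix.diagonal_mul_diagonal,
    Unitary.conjStarAlgAut_apply, Matrix.trace_mul_cycle]
  simp [Matrix.trace_diagonal, pow_two]

lemma matEntropy_ge_linear {ι : Type} [Fintype ι] [DecidableEq ι] {σ : Matrix ι ι ℂ}
    (h : σ.PosSemidef) : (σ.trace - (σ * σ).trace).re ≤ matEntropy σ := by
  have h' := h.isHermitian
  rw [matEntropy, dif_pos h', h'.trace_mul_self_eq_sum_eigenvalues_sq,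
    h'.trace_eq_sum_eigenvalues, ← Finset.sum_sub_distrib, Complex.re_sum]
  refine Finset.sum_le_sum fun i _ => ?_
  have h0 : 0 ≤ h'.eigenvalues i := h.eigenvalues_nonneg i
  have e : ((h'.eigenvalues i : ℂ) - (h'.eigenvalues i : ℂ) ^ 2).re
      = h'.eigenvalues i - h'.eigenvalues i ^ 2 := by norm_cast
  refine e.trans_le ?_
  rcases h0.eq_or_lt with h0 | h0
  · simp [← h0]
  · have := Real.log_le_sub_one_of_pos h0
    rw [Real.negMulLog]
    nlinarith

lemma matEntropy_eq_zero_of_idempotent {ι : Type} [Fintype ι] [DecidableEq ι] {σ : Matrix ι ι ℂ}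
    (h : σ * σ = σ) : matEntropy σ = 0 := by
  rw [matEntropy]
  split_ifs with hσ
  · refine Finset.sum_eq_zero fun i _ => ?_
    have hv := hσ.mulVec_eigenvectorBasis i
    set v := (hσ.eigenvectorBasis i).ofLp with hv_def
    have hv0 : v ≠ 0 := fun h0 => (hσ.eigenvectorBasis.orthonormal.ne_zero i) (by
      ext j; simpa [hv_def] using congrFun h0 j)
    have h2 : hσ.eigenvalues i • hσ.eigenvalues i • v = hσ.eigenvalues i • v := by
      rw [← hv, ← Matrix.mulVec_smul, ← hv, Matrix.mulVec_mulVec, h]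
    rw [smul_smul] at h2
    have h3 := smul_left_injective ℝ hv0 h2
    have h4 : hσ.eigenvalues i * (hσ.eigenvalues i - 1) = 0 := by
      linear_combination h3
    rcases mul_eq_zero.1 h4 with h | h
    · simp [h]
    · simp [sub_eq_zero.1 h]
  · rfl

section Gram

variable {X Y : Type} [Fintype X] [Fintype Y]

lemma sum_normSq_minor_le_matEntropy [DecidableEq X] (M : Matrix X Y ℂ) (hM : ∑ x, ∑ y, ‖M x y‖ ^ 2 = 1) :
    ∑ x, ∑ y, ∑ x', ∑ y', ‖M x y * M x' y' - M x' y * M x y'‖ ^ 2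
      ≤ 2 * matEntropy (M * M.conjTranspose) := by
  have hM' : ∑ x, ∑ y, M x y * star (M x y) = 1 := by
    rw [← Complex.ofReal_one, ← hM]
    push_cast
    simp [Complex.mul_conj']
  have htr : (M * M.conjTranspose).trace = 1 := by
    simpa [Matrix.trace, Matrix.mul_apply] using hM'
  have key := matEntropy_ge_linear (Matrix.posSemidef_self_mul_conjTranspose M)
  have hpur : ∑ x, ∑ y, ∑ x', ∑ y', (M x y * M x' y') * (star (M x' y) * star (M x y'))
      = (M * M.conjTranspose * (M * M.conjTranspose)).trace := by
    simp only [Matrix.trace, Matrix.diag, Matrix.mul_apply (M := M * M.conjTranspose)]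
    refine Finset.sum_congr rfl fun x _ => ?_
    rw [Finset.sum_comm]
    refine Finset.sum_congr rfl fun x' _ => ?_
    simp only [Matrix.mul_apply, Matrix.conjTranspose_apply, Finset.sum_mul_sum]
    refine Finset.sum_congr rfl fun y _ => Finset.sum_congr rfl fun y' _ => ?_
    ring
  have hswap : ∀ F : X → Y → X → Y → ℂ,
      ∑ x, ∑ y, ∑ x', ∑ y', F x' y x y' = ∑ x, ∑ y, ∑ x', ∑ y', F x y x' y' := fun F => by
    rw [Finset.sum_comm]
    conv_rhs => rw [Finset.sum_comm]
    exact Finset.sum_congr rfl fun y _ => Finset.sum_comm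
  have hpur' : ∑ x, ∑ y, ∑ x', ∑ y', (M x' y * M x y') * (star (M x y) * star (M x' y'))
      = (M * M.conjTranspose * (M * M.conjTranspose)).trace := by
    rw [← hpur, ← hswap]
  have hone : ∑ x, ∑ y, ∑ x', ∑ y', (M x y * M x' y') * (star (M x y) * star (M x' y')) = 1 := by
    have expand : ∀ x y x' y', (M x y * M x' y') * (star (M x y) * star (M x' y'))
        = M x y * star (M x y) * (M x' y' * star (M x' y')) := fun x y x' y' => by ring
    simp only [expand, ← Finset.mul_sum, hM', mul_one]
  have hone' : ∑ x, ∑ y, ∑ x', ∑ y', (M x' y * M x y') * (star (M x' y) * star (M x y')) = 1 := by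
    rw [← hone, ← hswap]
  have hsum : ((∑ x, ∑ y, ∑ x', ∑ y', ‖M x y * M x' y' - M x' y * M x y'‖ ^ 2 : ℝ) : ℂ)
      = 2 * ((M * M.conjTranspose).trace
        - (M * M.conjTranspose * (M * M.conjTranspose)).trace) := by
    have expand : ∀ x y x' y', ((‖M x y * M x' y' - M x' y * M x y'‖ : ℂ)) ^ 2
        = (M x y * M x' y') * (star (M x y) * star (M x' y'))
        + (M x' y * M x y') * (star (M x' y) * star (M x y'))
        - (M x y * M x' y') * (star (M x' y) * star (M x y'))
        - (M x' y * M x y') * (star (M x y) * star (M x' y')) := fun x y x' y' => by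
      rw [← Complex.mul_conj', ← starRingEnd_apply, ← starRingEnd_apply, ← starRingEnd_apply,
        ← starRingEnd_apply]
      simp only [map_sub, map_mul]
      ring
    push_cast
    simp only [expand, Finset.sum_sub_distrib, Finset.sum_add_distrib]
    rw [hpur, hpur', hone, hone', htr]
    ring
  have hre := congrArg Complex.re hsum
  rw [Complex.ofReal_re, show (2 : ℂ) = ((2 : ℝ) : ℂ) by norm_num,
    Complex.re_ofReal_mul] at hre
  linarith

lemma gram_idempotent_of_minor_eq_zero (M : Matrix X Y ℂ) (hM : ∑ x, ∑ y, ‖M x y‖ ^ 2 = 1)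
    (h : ∀ x y x' y', M x y * M x' y' = M x' y * M x y') :
    (M * M.conjTranspose) * (M * M.conjTranspose) = M * M.conjTranspose := by
  have hM' : ∑ x, ∑ y, M x y * star (M x y) = 1 := by
    rw [← Complex.ofReal_one, ← hM]
    push_cast
    simp [Complex.mul_conj']
  ext a b
  rw [Matrix.mul_apply]
  simp only [Matrix.mul_apply, Matrix.conjTranspose_apply, Finset.sum_mul_sum]
  have expand : ∀ x y y', M a y * star (M x y) * (M x y' * star (M b y'))
      = M x y * star (M x y) * (M a y' * star (M b y')) := fun x y y' => by
    linear_combination star (M x y) * star (M b y') * h a y x y'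
  simp only [expand, ← Finset.mul_sum, ← Finset.sum_mul, hM', one_mul]

end Gram

lemma piecewise_cut {κ : Type} [DecidableEq κ] {β : κ → Type} (s : Finset κ) (x x' : ∀ i : {j // j ∈ s}, β i.1)
    (y y' : ∀ i : {j // j ∉ s}, β i.1) :
    s.piecewise ((Equiv.piEquivPiSubtypeProd (· ∈ s) β).symm (x', y'))
      ((Equiv.piEquivPiSubtypeProd (· ∈ s) β).symm (x, y))
      = (Equiv.piEquivPiSubtypeProd (· ∈ s) β).symm (x', y) := by
  ext i
  by_cases h : i ∈ s <;> simp [Equiv.piEquivPiSubtypeProd, h]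

section Cut

variable {κ : Type} [Fintype κ] [DecidableEq κ] {β : κ → Type}
    [∀ i, Fintype (β i)]

/-- The amplitudes of `ψ` as a matrix, rows indexed by `s` and columns by its complement. -/
def cutMatrix (s : Finset κ) (ψ : (∀ i, β i) → ℂ) :
    Matrix (∀ i : {j // j ∈ s}, β i.1) (∀ i : {j // j ∉ s}, β i.1) ℂ :=
  Matrix.of fun x y => ψ ((Equiv.piEquivPiSubtypeProd (· ∈ s) β).symm (x, y))

lemma reduce_vecState (s : Finset κ) (ψ : (∀ i, β i) → ℂ) :
    reduce s (vecState ψ) = cutMatrix s ψ * (cutMatrix s ψ).conjTranspose := by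
  ext x y
  simp [reduce, vecState, cutMatrix, Matrix.mul_apply, Equiv.piEquivPiSubtypeProd]

lemma sum_eq_sum_cut {R : Type} [AddCommMonoid R] (s : Finset κ) (F : (∀ i, β i) → R) :
    ∑ f, F f = ∑ x, ∑ y, F ((Equiv.piEquivPiSubtypeProd (· ∈ s) β).symm (x, y)) := by
  rw [← Fintype.sum_prod_type', ← Equiv.sum_comp (Equiv.piEquivPiSubtypeProd (· ∈ s) β).symm]

lemma sum_normSq_swap_le_matEntropy [∀ i, DecidableEq (β i)] (s : Finset κ) (ψ : (∀ i, β i) → ℂ)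
    (hψ : ∑ F, ‖ψ F‖ ^ 2 = 1) :
    ∑ F, ∑ G, ‖ψ F * ψ G - ψ (s.piecewise G F) * ψ (s.piecewise F G)‖ ^ 2
      ≤ 2 * matEntropy (reduce s (vecState ψ)) := by
  rw [reduce_vecState]
  refine le_trans (le_of_eq ?_) (sum_normSq_minor_le_matEntropy (cutMatrix s ψ) ?_)
  · simp_rw [sum_eq_sum_cut s, piecewise_cut]
    rfl
  · rw [← hψ, sum_eq_sum_cut s]
    rfl

lemma matEntropy_reduce_vecState_nonneg [∀ i, DecidableEq (β i)] (s : Finset κ)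
    (ψ : (∀ i, β i) → ℂ) (hψ : ∑ F, ‖ψ F‖ ^ 2 = 1) :
    0 ≤ matEntropy (reduce s (vecState ψ)) := by
  have h := sum_normSq_swap_le_matEntropy s ψ hψ
  have h0 : 0 ≤ ∑ F, ∑ G, ‖ψ F * ψ G - ψ (s.piecewise G F) * ψ (s.piecewise F G)‖ ^ 2 := by
    positivity
  linarith

lemma matEntropy_reduce_vecState_eq_zero [∀ i, DecidableEq (β i)] (s : Finset κ)
    (ψ : (∀ i, β i) → ℂ) (hψ : ∑ F, ‖ψ F‖ ^ 2 = 1)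
    (h : ∀ F G, ψ F * ψ G = ψ (s.piecewise G F) * ψ (s.piecewise F G)) :
    matEntropy (reduce s (vecState ψ)) = 0 := by
  rw [reduce_vecState]
  refine matEntropy_eq_zero_of_idempotent (gram_idempotent_of_minor_eq_zero _ ?_ ?_)
  · rw [← hψ, sum_eq_sum_cut s]
    rfl
  · intro x y x' y'
    have := h ((Equiv.piEquivPiSubtypeProd (· ∈ s) β).symm (x, y))
      ((Equiv.piEquivPiSubtypeProd (· ∈ s) β).symm (x', y'))
    rw [piecewise_cut, piecewise_cut] at this
    exact this

end Cut

section Product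

lemma mul_prod_notMem_singleton {κ : Type} [Fintype κ] [DecidableEq κ] (i : κ) (F : κ → ℂ) :
    F i * ∏ j : {j // j ∉ ({i} : Finset κ)}, F j.1 = ∏ j, F j := by
  rw [← Finset.prod_mul_prod_compl {i} F, Finset.prod_singleton,
    ← Finset.prod_subtype ({i} : Finset κ)ᶜ (fun j => by simp) F]

variable {κ : Type} [Fintype κ] [DecidableEq κ] {α : κ → Type} [∀ i, Fintype (α i)]

lemma reduce_singleton_of_factorized {ρ : Matrix (∀ i, α i) (∀ i, α i) ℂ} {C : ℂ}
    {u : ∀ k, α k → α k → ℂ} (h : ∀ f g, ρ f g = C * ∏ k, u k (f k) (g k)) (i : κ)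
    (f g : ∀ i, α i) :
    reduce {i} ρ (fun j => f j.1) (fun j => g j.1)
      = C * (u i (f i) (g i) * ∏ j : {j // j ∉ ({i} : Finset κ)}, ∑ a, u j.1 a a) := by
  rw [Fintype.prod_sum, Finset.mul_sum, Finset.mul_sum]
  simp only [reduce, Matrix.of_apply, h]
  refine Finset.sum_congr rfl fun e _ => ?_
  congr 1
  rw [← mul_prod_notMem_singleton i]
  congr 1
  · simp
  · refine Finset.prod_congr rfl fun j _ => ?_
    rw [dif_neg j.2, dif_neg j.2]

lemma eq_prodMarginals_of_factorized {ρ : Matrix (∀ i, α i) (∀ i, α i) ℂ} (htr : ρ.trace = 1)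
    {C : ℂ} {u : ∀ k, α k → α k → ℂ} (h : ∀ f g, ρ f g = C * ∏ k, u k (f k) (g k)) :
    ρ = prodMarginals ρ := by
  have hT : C * ∏ k, ∑ a, u k a a = 1 := by
    rw [← htr, Fintype.prod_sum, Finset.mul_sum]
    simp [Matrix.trace, h]
  ext f g
  have hi : ∀ i, (∑ a, u i a a) * reduce {i} ρ (fun j => f j.1) (fun j => g j.1)
      = u i (f i) (g i) := fun i => by
    rw [reduce_singleton_of_factorized h]
    rw [← mul_prod_notMem_singleton i] at hT
    linear_combination u i (f i) (g i) * hT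
  rw [prodMarginals, Matrix.of_apply, h]
  simp only [← hi, Finset.prod_mul_distrib]
  linear_combination (∏ i, reduce {i} ρ (fun j => f j.1) (fun j => g j.1)) * hT

lemma eq_prodMarginals_of_minor_eq_zero {ρ : Matrix (∀ i, α i) (∀ i, α i) ℂ} (htr : ρ.trace = 1)
    (h : ∀ (k : κ) (f g f' g' : ∀ i, α i), ρ f g * ρ f' g'
      = ρ (Finset.piecewise {k} f' f) (Finset.piecewise {k} g' g)
        * ρ (Finset.piecewise {k} f f') (Finset.piecewise {k} g g')) :
    ρ = prodMarginals ρ := by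
  obtain ⟨f₀, -, h₀⟩ : ∃ f ∈ Finset.univ, ρ f f ≠ 0 :=
    Finset.exists_ne_zero_of_sum_ne_zero (htr.trans_ne one_ne_zero)
  let u : ∀ k, α k → α k → ℂ := fun k a b =>
    ρ (Function.update f₀ k a) (Function.update f₀ k b) / ρ f₀ f₀
  have hstep : ∀ k f g, ρ f g
      = u k (f k) (g k) * ρ (Function.update f k (f₀ k)) (Function.update g k (f₀ k)) := by
    intro k f g
    have := h k f g f₀ f₀
    simp only [Finset.piecewise_singleton] at this
    simp only [u]
    field_simp
    linear_combination this
  have hind : ∀ (s : Finset κ) f g, ρ f g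
      = (∏ k ∈ s, u k (f k) (g k)) * ρ (s.piecewise f₀ f) (s.piecewise f₀ g) := by
    intro s f g
    induction s using Finset.induction_on with
    | empty => simp
    | insert k s hk ih =>
      rw [Finset.prod_insert hk, Finset.piecewise_insert, Finset.piecewise_insert, ih,
        hstep k (s.piecewise f₀ f), Finset.piecewise_eq_of_notMem _ _ _ hk,
        Finset.piecewise_eq_of_notMem _ _ _ hk]
      ring
  refine eq_prodMarginals_of_factorized htr (C := ρ f₀ f₀) (u := u) fun f g => ?_
  rw [hind Finset.univ f g]
  simp [mul_comm]

end Product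

section Purification

lemma normSq_sum_sub_le {T : Type} [Fintype T] (p p' q q' : T → ℂ) {ε : ℝ}
    (hp' : ∑ t, ‖p' t‖ ^ 2 ≤ 1) (hq : ∑ t, ‖q t‖ ^ 2 ≤ 1)
    (hp : ∑ t, ‖p t - p' t‖ ^ 2 ≤ ε) (hq' : ∑ t, ‖q t - q' t‖ ^ 2 ≤ ε) :
    ‖∑ t, p t * star (q t) - ∑ t, p' t * star (q' t)‖ ^ 2 ≤ 4 * ε := by
  have hε : 0 ≤ ε := le_trans (by positivity) hp
  have hX : (∑ t, ‖p t - p' t‖ * ‖q t‖) ^ 2 ≤ ε :=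
    (Finset.sum_mul_sq_le_sq_mul_sq _ _ _).trans
      ((mul_le_mul hp hq (by positivity) hε).trans_eq (mul_one ε))
  have hY : (∑ t, ‖p' t‖ * ‖q t - q' t‖) ^ 2 ≤ ε :=
    (Finset.sum_mul_sq_le_sq_mul_sq _ _ _).trans
      ((mul_le_mul hp' hq' (by positivity) zero_le_one).trans_eq (one_mul ε))
  have hle : ‖∑ t, p t * star (q t) - ∑ t, p' t * star (q' t)‖
      ≤ ∑ t, ‖p t - p' t‖ * ‖q t‖ + ∑ t, ‖p' t‖ * ‖q t - q' t‖ := by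
    rw [← Finset.sum_sub_distrib, ← Finset.sum_add_distrib]
    refine (norm_sum_le _ _).trans (Finset.sum_le_sum fun t _ => ?_)
    have : p t * star (q t) - p' t * star (q' t)
        = (p t - p' t) * star (q t) + p' t * star (q t - q' t) := by
      rw [star_sub]
      ring
    rw [this]
    refine (norm_add_le _ _).trans_eq ?_
    rw [norm_mul, norm_mul, norm_star, norm_star]
  have h2 := pow_le_pow_left₀ (norm_nonneg _) hle 2
  nlinarith [sq_nonneg (∑ t, ‖p t - p' t‖ * ‖q t‖ - ∑ t, ‖p' t‖ * ‖q t - q' t‖)]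

variable {κ : Type} [Fintype κ] [DecidableEq κ] {α : κ → Type} [∀ i, Fintype (α i)]
  {d : κ → ℕ}

lemma sum_eq_sum_mergeSum {R : Type} [AddCommMonoid R]
    (F : (∀ i : κ ⊕ κ, Sum.elim α (fun k => Fin (d k)) i) → R) :
    ∑ f, F f = ∑ f : ∀ i, α i, ∑ h : ∀ k, Fin (d k), F (mergeSum f h) := by
  rw [← Fintype.sum_prod_type' (f := fun f h => F (mergeSum f h))]
  refine Fintype.sum_equiv (Equiv.sumPiEquivProdPi _) _ _ fun f => ?_
  congr 1
  ext i
  cases i <;> rfl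

lemma piecewise_partyFinset {κ : Type} [Fintype κ] [DecidableEq κ] {α : κ → Type}
    {δ : κ → Type} (k : κ) (f f' : ∀ i, α i) (h h' : ∀ k, δ k) :
    (partyFinset id k).piecewise (mergeSum f' h') (mergeSum f h)
      = mergeSum (Finset.piecewise {k} f' f) (Finset.piecewise {k} h' h) := by
  ext i
  cases i with
  | inl a =>
    rcases eq_or_ne a k with ha | ha
    · simp [Finset.piecewise, partyFinset, mergeSum, ha]
    · simp [Finset.piecewise, partyFinset, mergeSum, ha, ha.symm]
  | inr a => by_cases ha : a = k <;> simp [Finset.piecewise, partyFinset, mergeSum, ha]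

lemma Purifies.diag {ψ : (∀ i : κ ⊕ κ, Sum.elim α (fun k => Fin (d k)) i) → ℂ}
    {ρ : Matrix (∀ i, α i) (∀ i, α i) ℂ} (h : Purifies ψ ρ) (f : ∀ i, α i) :
    ((∑ e : ∀ k, Fin (d k), ‖ψ (mergeSum f e)‖ ^ 2 : ℝ) : ℂ) = ρ f f := by
  rw [← h f f]
  push_cast
  simp [vecState, Complex.mul_conj']

lemma Purifies.sum_normSq {ψ : (∀ i : κ ⊕ κ, Sum.elim α (fun k => Fin (d k)) i) → ℂ}
    {ρ : Matrix (∀ i, α i) (∀ i, α i) ℂ} (h : Purifies ψ ρ) (htr : ρ.trace = 1) :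
    ∑ F, ‖ψ F‖ ^ 2 = 1 := by
  rw [sum_eq_sum_mergeSum, ← Complex.ofReal_inj, Complex.ofReal_sum, Complex.ofReal_one, ← htr]
  exact Finset.sum_congr rfl fun f _ => h.diag f

lemma Purifies.normSq_minor_le [∀ i, DecidableEq (α i)]
    {ψ : (∀ i : κ ⊕ κ, Sum.elim α (fun k => Fin (d k)) i) → ℂ}
    {ρ : Matrix (∀ i, α i) (∀ i, α i) ℂ} (h : Purifies ψ ρ) (htr : ρ.trace = 1)
    (k : κ) (f g f' g' : ∀ i, α i) :
    ‖ρ f g * ρ f' g' - ρ (Finset.piecewise {k} f' f) (Finset.piecewise {k} g' g)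
        * ρ (Finset.piecewise {k} f f') (Finset.piecewise {k} g g')‖ ^ 2
      ≤ 8 * matEntropy (reduce (partyFinset id k) (vecState ψ)) := by
  have hψ := h.sum_normSq htr
  let Λ := ∀ k, Fin (d k)
  let P : (∀ i, α i) → (∀ i, α i) → Λ × Λ → ℂ :=
    fun f f' t => ψ (mergeSum f t.1) * ψ (mergeSum f' t.2)
  let σ : Λ × Λ → Λ × Λ := fun t => (Finset.piecewise {k} t.2 t.1, Finset.piecewise {k} t.1 t.2)
  have hσ : Function.Involutive σ := fun t => by
    ext i <;> by_cases hi : i = k <;> simp [σ, hi]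
  have hcol (f : ∀ i, α i) : ∑ e : Λ, ‖ψ (mergeSum f e)‖ ^ 2 ≤ 1 := by
    rw [← hψ, sum_eq_sum_mergeSum]
    exact Finset.single_le_sum (f := fun f => ∑ e : Λ, ‖ψ (mergeSum f e)‖ ^ 2)
      (fun _ _ => by positivity) (Finset.mem_univ f)
  have hP (f f' : ∀ i, α i) : ∑ t, ‖P f f' t‖ ^ 2 ≤ 1 := by
    have : ∑ t, ‖P f f' t‖ ^ 2
        = (∑ e : Λ, ‖ψ (mergeSum f e)‖ ^ 2) * ∑ e : Λ, ‖ψ (mergeSum f' e)‖ ^ 2 := by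
      rw [Fintype.sum_mul_sum, Fintype.sum_prod_type]
      simp only [P, norm_mul, mul_pow]
    rw [this]
    exact mul_le_one₀ (hcol f) (by positivity) (hcol f')
  have hρ (f g f' g' : ∀ i, α i) : ρ f g * ρ f' g' = ∑ t, P f f' t * star (P g g' t) := by
    rw [← h f g, ← h f' g', Fintype.sum_mul_sum, Fintype.sum_prod_type]
    refine Finset.sum_congr rfl fun e _ => Finset.sum_congr rfl fun e' _ => ?_
    simp only [P, vecState, Matrix.of_apply, star_mul']
    ring
  have hdiff (f f' : ∀ i, α i) :
      ∑ t, ‖P f f' t - P (Finset.piecewise {k} f' f) (Finset.piecewise {k} f f') (σ t)‖ ^ 2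
        ≤ 2 * matEntropy (reduce (partyFinset id k) (vecState ψ)) := by
    refine le_trans ?_ (sum_normSq_swap_le_matEntropy (partyFinset id k) ψ hψ)
    rw [sum_eq_sum_mergeSum]
    refine le_trans ?_ (Finset.single_le_sum (fun _ _ => by positivity) (Finset.mem_univ f))
    rw [Fintype.sum_prod_type]
    refine Finset.sum_le_sum fun e _ => ?_
    rw [sum_eq_sum_mergeSum]
    refine le_trans (le_of_eq ?_)
      (Finset.single_le_sum (fun _ _ => by positivity) (Finset.mem_univ f'))
    simp only [piecewise_partyFinset, P, σ]
    rfl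
  rw [hρ, hρ, ← Equiv.sum_comp hσ.toPerm (fun t => P (Finset.piecewise {k} f' f)
    (Finset.piecewise {k} f f') t * _)]
  refine (normSq_sum_sub_le _ _ _ _ ?_ (hP g g') (hdiff f f') (hdiff g g')).trans_eq (by ring)
  exact (Equiv.sum_comp hσ.toPerm (fun t => ‖P (Finset.piecewise {k} f' f)
    (Finset.piecewise {k} f f') t‖ ^ 2)).trans_le (hP _ _)

end Purification

section Existence

open scoped MatrixOrder Matrix.Norms.L2Operator in
lemma Matrix.PosSemidef.exists_eq_mul_conjTranspose {ι : Type} [Fintype ι] [DecidableEq ι]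
    {A : Matrix ι ι ℂ} (hA : A.PosSemidef) : ∃ B : Matrix ι ι ℂ, A = B * B.conjTranspose :=
  CStarAlgebra.nonneg_iff_eq_mul_star_self.1 hA.nonneg

lemma Matrix.PosSemidef.reduce {κ : Type} [Fintype κ] [DecidableEq κ] {α : κ → Type}
    [∀ i, Fintype (α i)] {ρ : Matrix (∀ i, α i) (∀ i, α i) ℂ} (hρ : ρ.PosSemidef)
    (s : Finset κ) : (reduce s ρ).PosSemidef := by
  have : _root_.reduce s ρ = ∑ h : ∀ i : {j // j ∉ s}, α i.1,
      ρ.submatrix (fun f i => if hi : i ∈ s then f ⟨i, hi⟩ else h ⟨i, hi⟩)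
        (fun f i => if hi : i ∈ s then f ⟨i, hi⟩ else h ⟨i, hi⟩) := by
    ext f g
    simp [_root_.reduce, Matrix.sum_apply]
  rw [this]
  exact Matrix.posSemidef_sum _ fun h _ => hρ.submatrix _

variable {κ : Type} [Fintype κ] [DecidableEq κ] {α : κ → Type} [∀ i, Fintype (α i)]

lemma exists_purifies [∀ i, DecidableEq (α i)] {ρ : Matrix (∀ i, α i) (∀ i, α i) ℂ}
    (hρ : ρ.PosSemidef) :
    ∃ (d : κ → ℕ) (ψ : (∀ i : κ ⊕ κ, Sum.elim α (fun k => Fin (d k)) i) → ℂ),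
      Purifies ψ ρ := by
  obtain ⟨B, hB⟩ := hρ.exists_eq_mul_conjTranspose
  refine ⟨fun k => Fintype.card (α k), fun F => B (fun i => F (.inl i))
    (fun i => (Fintype.equivFin (α i)).symm (F (.inr i))), fun f g => ?_⟩
  rw [hB, Matrix.mul_apply]
  exact Fintype.sum_equiv (Equiv.piCongrRight fun i => (Fintype.equivFin (α i)).symm) _ _
    fun _ => rfl

lemma exists_purifies_swap_invariant [∀ i, DecidableEq (α i)]
    {ρ : Matrix (∀ i, α i) (∀ i, α i) ℂ} (hρ : ρ.PosSemidef) (hprod : ρ = prodMarginals ρ) :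
    ∃ (d : κ → ℕ) (ψ : (∀ i : κ ⊕ κ, Sum.elim α (fun k => Fin (d k)) i) → ℂ),
      Purifies ψ ρ ∧ ∀ k F G, ψ F * ψ G = ψ ((partyFinset id k).piecewise G F)
        * ψ ((partyFinset id k).piecewise F G) := by
  choose B hB using fun i : κ => (hρ.reduce {i}).exists_eq_mul_conjTranspose
  let e (i : κ) := Fintype.equivFin (∀ j : {j // j ∈ ({i} : Finset κ)}, α j.1)
  let φ (i : κ) (F : ∀ i : κ ⊕ κ, Sum.elim α
      (fun i : κ => Fin (Fintype.card (∀ j : {j // j ∈ ({i} : Finset κ)}, α j.1))) i) : ℂ :=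
    B i (fun j => F (.inl j.1)) ((e i).symm (F (.inr i)))
  have hφ : ∀ i F G, F (.inl i) = G (.inl i) → F (.inr i) = G (.inr i) → φ i F = φ i G := by
    intro i F G h1 h2
    have : (fun j : {j // j ∈ ({i} : Finset κ)} => F (.inl j.1)) =
        fun j : {j // j ∈ ({i} : Finset κ)} => G (.inl j.1) := by
      funext ⟨j, hj⟩
      obtain rfl := Finset.mem_singleton.1 hj
      exact h1
    simp only [φ, h2]
    exact congrArg (fun x => B i x _) this
  refine ⟨fun i => Fintype.card (∀ j : {j // j ∈ ({i} : Finset κ)}, α j.1),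
    fun F => ∏ i, φ i F, fun f g => ?_, fun k F G => ?_⟩
  · rw [hprod, prodMarginals, Matrix.of_apply]
    simp only [vecState, Matrix.of_apply, star_prod, ← Finset.prod_mul_distrib, φ]
    have hterm : ∀ i, reduce {i} ρ (fun j => f j.1) (fun j => g j.1)
        = ∑ a, B i (fun j => f j.1) ((e i).symm a) * star (B i (fun j => g j.1) ((e i).symm a)) :=
      fun i => by
        rw [hB i, Matrix.mul_apply, ← Equiv.sum_comp (e i).symm]
        rfl
    simp only [hterm, Fintype.prod_sum]
    rfl
  · simp only [← Finset.prod_mul_distrib]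
    refine Finset.prod_congr rfl fun i _ => ?_
    by_cases hi : i = k
    · have hl : Sum.inl i ∈ partyFinset (id : κ → κ) k := by simp [partyFinset, hi]
      have hr : Sum.inr i ∈ partyFinset (id : κ → κ) k := by simp [partyFinset, hi]
      have h1 := hφ i ((partyFinset id k).piecewise G F) G
        (Finset.piecewise_eq_of_mem _ _ _ hl) (Finset.piecewise_eq_of_mem _ _ _ hr)
      have h2 := hφ i ((partyFinset id k).piecewise F G) F
        (Finset.piecewise_eq_of_mem _ _ _ hl) (Finset.piecewise_eq_of_mem _ _ _ hr)
      exact (mul_comm _ _).trans (congrArg₂ (· * ·) h1 h2).symm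
    · have hl : Sum.inl i ∉ partyFinset (id : κ → κ) k := by simp [partyFinset, Ne.symm hi]
      have hr : Sum.inr i ∉ partyFinset (id : κ → κ) k := by simp [partyFinset, hi]
      have h1 := hφ i ((partyFinset id k).piecewise G F) F
        (Finset.piecewise_eq_of_notMem _ _ _ hl) (Finset.piecewise_eq_of_notMem _ _ _ hr)
      have h2 := hφ i ((partyFinset id k).piecewise F G) G
        (Finset.piecewise_eq_of_notMem _ _ _ hl) (Finset.piecewise_eq_of_notMem _ _ _ hr)
      exact (congrArg₂ (· * ·) h1 h2).symm

end Existence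

/-- `Δ_P` vanishes iff the state is fully product. -/
theorem DeltaP_eq_zero_iff_product {n : ℕ} {α : Fin n → Type}
    [∀ i, Fintype (α i)] [∀ i, DecidableEq (α i)]
    (ρ : Matrix (∀ i, α i) (∀ i, α i) ℂ) (hρ : IsDensityMatrix ρ) :
    DeltaPart id ρ = 0 ↔ ρ = prodMarginals ρ := by
  obtain ⟨hpos, htr⟩ := hρ
  constructor
  · intro h0
    obtain ⟨d₀, ψ₀, h₀⟩ := exists_purifies hpos
    refine eq_prodMarginals_of_minor_eq_zero htr fun k f g f' g' => ?_
    rw [← sub_eq_zero, ← norm_eq_zero, ← sq_eq_zero_iff]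
    refine le_antisymm (le_of_forall_pos_le_add fun ε hε => ?_) (by positivity)
    rw [DeltaPart] at h0
    have hlt := h0.trans_lt (by positivity : 0 < ε / 8)
    obtain ⟨x, ⟨d, ψ, hψ, rfl⟩, hx⟩ :=
      exists_lt_of_csInf_lt (by exact ⟨_, d₀, ψ₀, h₀, rfl⟩) hlt
    have hk := Finset.single_le_sum
      (f := fun k => matEntropy (reduce (partyFinset id k) (vecState ψ)))
      (fun k _ => matEntropy_reduce_vecState_nonneg _ ψ (hψ.sum_normSq htr)) (Finset.mem_univ k)
    have hm := hψ.normSq_minor_le htr k f g f' g'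
    linarith
  · intro hprod
    obtain ⟨d, ψ, hψ, hswap⟩ := exists_purifies_swap_invariant hpos hprod
    have hnonneg : ∀ x ∈ { x | ∃ (d : Fin n → ℕ)
        (ψ : (∀ i : Fin n ⊕ Fin n, Sum.elim α (fun k => Fin (d k)) i) → ℂ), Purifies ψ ρ ∧
        x = ∑ k, matEntropy (reduce (partyFinset id k) (vecState ψ)) }, 0 ≤ x := by
      rintro x ⟨d, ψ, hψ, rfl⟩
      exact Finset.sum_nonneg fun k _ =>
        matEntropy_reduce_vecState_nonneg _ ψ (hψ.sum_normSq htr)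
    refine le_antisymm (csInf_le ⟨0, hnonneg⟩ ⟨d, ψ, hψ, ?_⟩) (Real.sInf_nonneg hnonneg)
    exact (Finset.sum_eq_zero fun k _ => matEntropy_reduce_vecState_eq_zero _ ψ
      (hψ.sum_normSq htr) (hswap k)).symm
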